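/- arXiv:2006.04319 — 4 statements merged into one kernel-verified Lean document; each statement's English description precedes it below -/
import Mathlib

section
/- For every natural number n ≥ 4, the number of splits of an n-element set compatible with a fixed circular ordering equals n(n-3)/2. Formally: the cardinality of {A : Finset (ZMod n) | (0 : ZMod n) ∈ A ∧ A is an arc of ZMod n} equals n * (n - 3) / 2 (the complement of an arc of length l with 2 ≤ l ≤ n-2 is again such an arc, so each unordered pair {A, Aᶜ} of complementary arcs is counted once by its member containing 0). -/
/-- An arc of `ZMod n`: a finset of the form `{a, a+1, …, a+l-1}` with `2 ≤ l ≤ n - 2`. -/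
def IsArc (n : ℕ) (A : Finset (ZMod n)) : Prop :=
  ∃ (a : ZMod n) (l : ℕ), 2 ≤ l ∧ l ≤ n - 2 ∧
    A = (Finset.range l).image (fun (j : ℕ) => a + (j : ZMod n))

def arcF (n : ℕ) (a : ZMod n) (l : ℕ) : Finset (ZMod n) :=
  (Finset.range l).image (fun (j : ℕ) => a + (j : ZMod n))

lemma cast_inj_lt {n i j : ℕ} (hi : i < n) (hj : j < n) (h : (i : ZMod n) = j) : i = j := by
  rw [ZMod.natCast_eq_natCast_iff] at h
  exact Nat.ModEq.eq_of_lt_of_lt h hi hj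

lemma arcF_card {n : ℕ} (a : ZMod n) {l : ℕ} (hl : l ≤ n) : (arcF n a l).card = l := by
  unfold arcF
  rw [Finset.card_image_of_injOn, Finset.card_range]
  intro i hi j hj h
  simp only [Finset.coe_range, Set.mem_Iio] at hi hj
  exact cast_inj_lt (by omega) (by omega) (add_left_cancel h)

lemma arcF_start {n : ℕ} {a b : ZMod n} {l : ℕ} (h0 : 0 < l) (hl : l < n)
    (h : arcF n a l = arcF n b l) : a = b := by
  have ha : a ∈ arcF n b l := by
    rw [← h]
    exact Finset.mem_image.2 ⟨0, Finset.mem_range.2 h0, by simp⟩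
  have ha' : a - 1 ∉ arcF n b l := by
    rw [← h]
    intro hm
    obtain ⟨j, hj, hj'⟩ := Finset.mem_image.1 hm
    rw [Finset.mem_range] at hj
    have h1 : ((j + 1 : ℕ) : ZMod n) = 0 := by
      push_cast
      linear_combination hj'
    rw [ZMod.natCast_eq_zero_iff] at h1
    have := Nat.le_of_dvd (by omega) h1
    omega
  obtain ⟨j, hj, hj'⟩ := Finset.mem_image.1 ha
  rw [Finset.mem_range] at hj
  rcases j with _ | j
  · simpa using hj'.symm
  · exfalso
    apply ha'
    refine Finset.mem_image.2 ⟨j, Finset.mem_range.2 (by omega), ?_⟩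
    push_cast at hj'
    linear_combination hj'

lemma sum_aux (m : ℕ) : (∑ l ∈ Finset.Icc 2 (m + 2), l) * 2 = (m + 4) * (m + 1) := by
  induction m with
  | zero => simp
  | succ k ih =>
    rw [show k + 1 + 2 = (k + 2) + 1 from rfl, Finset.sum_Icc_succ_top (by omega), add_mul, ih]
    ring

theorem card_circular_splits (n : ℕ) (hn : 4 ≤ n) :
    Nat.card {A : Finset (ZMod n) | (0 : ZMod n) ∈ A ∧ IsArc n A} = n * (n - 3) / 2 := by
  classical
  let S : Finset (Σ _ : ℕ, ℕ) := (Finset.Icc 2 (n - 2)).sigma (fun l => Finset.range l)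
  let f : (Σ _ : ℕ, ℕ) → Finset (ZMod n) := fun p => arcF n (-(p.2 : ZMod n)) p.1
  have hS : {A : Finset (ZMod n) | (0 : ZMod n) ∈ A ∧ IsArc n A} = ↑(S.image f) := by
    ext A
    simp only [Set.mem_ofPred_eq, Finset.coe_image, Set.mem_image, Finset.mem_coe, S, f,
      Finset.mem_sigma, Finset.mem_Icc, Finset.mem_range]
    constructor
    · rintro ⟨h0, a, l, h2, hl, rfl⟩
      obtain ⟨k, hk, hk'⟩ := Finset.mem_image.1 h0
      refine ⟨⟨l, k⟩, ⟨⟨h2, hl⟩, Finset.mem_range.1 hk⟩, ?_⟩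
      have : a = -(k : ZMod n) := by linear_combination hk'
      rw [this]
      rfl
    · rintro ⟨⟨l, k⟩, ⟨⟨h2, hl⟩, hk⟩, rfl⟩
      exact ⟨Finset.mem_image.2 ⟨k, Finset.mem_range.2 hk, by simp⟩, _, l, h2, hl, rfl⟩
  have hinj : Set.InjOn f S := by
    rintro ⟨l, k⟩ h ⟨l', k'⟩ h' e
    simp only [S, Finset.mem_coe, Finset.mem_sigma, Finset.mem_Icc, Finset.mem_range] at h h'
    simp only [f] at e
    have hl : l = l' := by
      have := congrArg Finset.card e
      rwa [arcF_card _ (by omega), arcF_card _ (by omega)] at this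
    subst hl
    have := neg_injective (arcF_start (by omega) (by omega) e)
    rw [cast_inj_lt (by omega) (by omega) this]
  rw [hS, Nat.card_coe_set_eq, Set.ncard_coe_finset, Finset.card_image_of_injOn hinj,
    Finset.card_sigma]
  simp only [Finset.card_range]
  obtain ⟨m, rfl⟩ := Nat.exists_eq_add_of_le' hn
  have := sum_aux m
  rw [show m + 4 - 2 = m + 2 by omega, show m + 4 - 3 = m + 1 by omega]
  omega
end

section
/- Every pairwise compatible set of splits is circular: for every n ≥ 4 and every finite set S of pairwise compatible splits of Fin n, there exists a bijection σ : Fin n ≃ ZMod n such that for every A ∈ S, the image of A under σ is an arc of ZMod n. (This is the paper's claim that a set of pairwise compatible splits can always be arranged to be compatible with a cyclic ordering, i.e., BHV_n embeds in CSN_n.) -/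
/-- A split of `Fin n`: a subset `A` with `2 ≤ |A|` and `2 ≤ |Aᶜ|`, representing the
unordered bipartition `{A, Aᶜ}` of the `n` leaves. -/
def IsSplit (n : ℕ) (A : Finset (Fin n)) : Prop :=
  2 ≤ A.card ∧ 2 ≤ Aᶜ.card

/-- Two splits are compatible if one of the four corner intersections is empty. -/
def SplitCompatible {n : ℕ} (A B : Finset (Fin n)) : Prop :=
  A ∩ B = ∅ ∨ A ∩ Bᶜ = ∅ ∨ Aᶜ ∩ B = ∅ ∨ Aᶜ ∩ Bᶜ = ∅

theorem laminar_list {α : Type*} [DecidableEq α] (F : Finset (Finset α))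
    (hF : ∀ A ∈ F, ∀ B ∈ F, Disjoint A B ∨ A ⊆ B ∨ B ⊆ A) (k : ℕ) :
    ∀ U : Finset α, U.card = k → ∃ l : List α, l.Nodup ∧ l.toFinset = U ∧
      ∀ A ∈ F, A ⊆ U → ∃ s m t : List α, l = s ++ m ++ t ∧ m.toFinset = A := by
  induction k using Nat.strong_induction_on with
  | _ k ih =>
  intro U hU
  by_cases hne : (F.filter (fun A => A ⊂ U ∧ A.Nonempty)).Nonempty
  · obtain ⟨A, hA, hmax⟩ := Finset.exists_max_image _ Finset.card hne
    simp only [Finset.mem_filter] at hA hmax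
    obtain ⟨hAF, hAU, hAne⟩ := hA
    have h1 : A.card < k := hU ▸ Finset.card_lt_card hAU
    have h2 : (U \ A).card < k := by
      rw [Finset.card_sdiff_of_subset hAU.1]
      have := hAne.card_pos
      omega
    obtain ⟨l1, hn1, ht1, hi1⟩ := ih _ h1 A rfl
    obtain ⟨l2, hn2, ht2, hi2⟩ := ih _ h2 (U \ A) rfl
    refine ⟨l1 ++ l2, ?_, ?_, ?_⟩
    · rw [List.nodup_append']
      refine ⟨hn1, hn2, ?_⟩
      rw [← List.disjoint_toFinset_iff_disjoint, ht1, ht2]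
      exact Finset.disjoint_sdiff
    · rw [List.toFinset_append, ht1, ht2]
      exact Finset.union_sdiff_of_subset hAU.1
    · intro B hB hBU
      rcases hF A hAF B hB with h | h | h
      · obtain ⟨s, m, t, e, hm⟩ := hi2 B hB (by
          rw [Finset.subset_sdiff]; exact ⟨hBU, h.symm⟩)
        exact ⟨l1 ++ s, m, t, by simp [e], hm⟩
      · by_cases hBe : B = U
        · refine ⟨[], l1 ++ l2, [], by simp, ?_⟩
          rw [List.toFinset_append, ht1, ht2, hBe]
          exact Finset.union_sdiff_of_subset hAU.1
        · have h3 := hmax B ⟨hB, hBU.ssubset_of_ne hBe, hAne.mono h⟩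
          have h4 := Finset.eq_of_subset_of_card_le h h3
          exact ⟨[], l1, l2, by simp, h4 ▸ ht1⟩
      · obtain ⟨s, m, t, e, hm⟩ := hi1 B hB h
        exact ⟨s, m, t ++ l2, by simp [e], hm⟩
  · refine ⟨U.toList, U.nodup_toList, U.toList_toFinset, ?_⟩
    intro B hB hBU
    by_cases hBe : B = U
    · exact ⟨[], U.toList, [], by simp, by simp [hBe]⟩
    · have : B = ∅ := by
        by_contra h
        exact hne ⟨B, by
          simp only [Finset.mem_filter]
          exact ⟨hB, hBU.ssubset_of_ne hBe, Finset.nonempty_iff_ne_empty.2 h⟩⟩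
      exact ⟨[], [], U.toList, by simp, by simp [this]⟩

theorem isArc_compl {n : ℕ} [NeZero n] {A : Finset (ZMod n)} (h : IsArc n A) : IsArc n Aᶜ := by
  obtain ⟨a, l, h2, hl, rfl⟩ := h
  refine ⟨a + l, n - l, by omega, by omega, ?_⟩
  ext x
  simp only [Finset.mem_compl, Finset.mem_image, Finset.mem_range, not_exists, not_and]
  constructor
  · intro h
    have hx : a + ((x - a).val : ZMod n) = x := by rw [ZMod.natCast_zmod_val]; ring
    have hlt := ZMod.val_lt (x - a)
    have hge : l ≤ (x - a).val := by
      by_contra hc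
      exact h _ (by omega) hx
    refine ⟨(x - a).val - l, by omega, ?_⟩
    rw [add_assoc, ← Nat.cast_add, Nat.add_sub_cancel' hge, hx]
  · rintro ⟨i, hi, rfl⟩ j hj he
    rw [add_assoc, ← Nat.cast_add] at he
    have he := add_left_cancel he
    rw [ZMod.natCast_eq_natCast_iff'] at he
    rw [Nat.mod_eq_of_lt (by omega), Nat.mod_eq_of_lt (by omega)] at he
    omega

theorem pairwise_compatible_is_circular (n : ℕ) (hn : 4 ≤ n)
    (S : Finset (Finset (Fin n)))
    (hsplit : ∀ A ∈ S, IsSplit n A)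
    (hcompat : ∀ A ∈ S, ∀ B ∈ S, SplitCompatible A B) :
    ∃ σ : Fin n ≃ ZMod n, ∀ A ∈ S, IsArc n (A.image σ) := by
  have : NeZero n := ⟨by omega⟩
  let f : Finset (Fin n) → Finset (Fin n) := fun A => if (0 : Fin n) ∈ A then Aᶜ else A
  have hf : ∀ A, f A = A ∨ f A = Aᶜ := by
    intro A; by_cases h : (0 : Fin n) ∈ A <;> simp [f, h]
  have hf0 : ∀ A, (0 : Fin n) ∉ f A := by
    intro A; by_cases h : (0 : Fin n) ∈ A <;> simp [f, h]
  have key : ∀ A B : Finset (Fin n), (0 : Fin n) ∉ A → (0 : Fin n) ∉ B → SplitCompatible A B →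
      Disjoint A B ∨ A ⊆ B ∨ B ⊆ A := by
    intro A B hA hB h
    rcases h with h | h | h | h
    · exact Or.inl (Finset.disjoint_iff_inter_eq_empty.2 h)
    · right; left
      rwa [← Finset.sdiff_eq_inter_compl, Finset.sdiff_eq_empty_iff_subset] at h
    · right; right
      rwa [Finset.inter_comm, ← Finset.sdiff_eq_inter_compl,
        Finset.sdiff_eq_empty_iff_subset] at h
    · exfalso
      have : (0 : Fin n) ∈ Aᶜ ∩ Bᶜ := by simp [hA, hB]
      rw [h] at this
      simp at this
  have hc : ∀ A ∈ S, ∀ B ∈ S, SplitCompatible (f A) (f B) := by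
    intro A hA B hB
    have h := hcompat A hA B hB
    unfold SplitCompatible at h ⊢
    rcases hf A with e | e <;> rcases hf B with e' | e' <;> rw [e, e'] <;>
      (try simp only [compl_compl]) <;> tauto
  have hsp : ∀ A ∈ S, IsSplit n (f A) := by
    intro A hA
    have h := hsplit A hA
    unfold IsSplit at h ⊢
    rcases hf A with e | e <;> rw [e] <;> (try simp only [compl_compl]) <;> tauto
  obtain ⟨l, hnd, hl, hi⟩ := laminar_list (S.image f) (by
    intro A hA B hB
    obtain ⟨A, hA', rfl⟩ := Finset.mem_image.1 hA
    obtain ⟨B, hB', rfl⟩ := Finset.mem_image.1 hB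
    exact key _ _ (hf0 A) (hf0 B) (hc A hA' B hB')) _ Finset.univ rfl
  have hmem : ∀ x, x ∈ l := fun x => by rw [← List.mem_toFinset, hl]; simp
  have hlen : l.length = n := by
    rw [← List.toFinset_card_of_nodup hnd, hl]; simp
  let g : Fin n → ZMod n := fun x => (l.idxOf x : ZMod n)
  have hg : Function.Injective g := by
    intro x y h
    have hx := List.idxOf_lt_length_iff.2 (hmem x)
    have hy := List.idxOf_lt_length_iff.2 (hmem y)
    simp only [g] at h
    rw [ZMod.natCast_eq_natCast_iff', Nat.mod_eq_of_lt (by omega),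
      Nat.mod_eq_of_lt (by omega)] at h
    exact (List.idxOf_inj (hmem x)).1 h
  have hbij : Function.Bijective g := by
    rw [Fintype.bijective_iff_injective_and_card]
    exact ⟨hg, by simp [ZMod.card]⟩
  have hfarc : ∀ A ∈ S, IsArc n ((f A).image g) := by
    intro A hA
    obtain ⟨s, m, t, e, hm⟩ := hi (f A) (Finset.mem_image_of_mem _ hA) (Finset.subset_univ _)
    have hmn : m.Nodup := by
      rw [e] at hnd
      exact (List.nodup_append'.1 (List.nodup_append'.1 hnd).1).2.1
    have hcard : m.length = (f A).card := by rw [← hm, List.toFinset_card_of_nodup hmn]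
    obtain ⟨h1, h2⟩ := hsp A hA
    rw [Finset.card_compl, Fintype.card_fin] at h2
    have hget : ∀ j (hj : j < m.length), l.idxOf m[j] = s.length + j := by
      intro j hj
      have hlt : s.length + j < l.length := by rw [e]; simp; omega
      have : m[j] = l[s.length + j] := by
        subst e
        simp [hj]
      rw [this, hnd.idxOf_getElem]
    refine ⟨(s.length : ZMod n), m.length, by omega, by omega, ?_⟩
    ext x
    simp only [Finset.mem_image, Finset.mem_range, ← hm, List.mem_toFinset, g]
    constructor
    · rintro ⟨y, hy, rfl⟩
      obtain ⟨j, hj, rfl⟩ := List.getElem_of_mem hy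
      exact ⟨j, hj, by rw [hget j hj]; push_cast; rfl⟩
    · rintro ⟨j, hj, rfl⟩
      exact ⟨m[j], List.getElem_mem hj, by rw [hget j hj]; push_cast; rfl⟩
  refine ⟨Equiv.ofBijective g hbij, ?_⟩
  intro A hA
  have h := hfarc A hA
  change IsArc n (A.image g)
  rcases hf A with e | e
  · rwa [e] at h
  · rw [e] at h
    have h' := isArc_compl h
    have himg : (Aᶜ.image g)ᶜ = A.image g := by
      apply Finset.coe_injective
      push_cast
      rw [Set.image_compl_eq hbij, compl_compl]
    rwa [himg] at h'
end

section
/- Let V be a finite type and G : SimpleGraph V a tree (G.IsTree). Suppose the set of leaves L = {v | G.degree v = 1} has cardinality n with n ≥ 3, and that every vertex of G has degree 1 or degree ≥ 3. Then the number of internal edges of G — edges both of whose endpoints have degree ≥ 3 — is at most n - 3, and equality holds if and only if every non-leaf vertex has degree exactly 3 (i.e., the tree is binary). -/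
open scoped Classical in
theorem aux_leaf_leaf (V : Type*) [Fintype V] (G : SimpleGraph V)
    [DecidableRel G.Adj] (hT : G.IsTree)
    (hn : 3 ≤ (Finset.univ.filter (fun v => G.degree v = 1)).card) (u v : V)
    (hu : G.degree u = 1) (hv : G.degree v = 1) (huv : G.Adj u v) : False := by
  obtain ⟨a, ha, hau⟩ := SimpleGraph.degree_eq_one_iff_existsUnique_adj.mp hu
  obtain ⟨b, hb, hbu⟩ := SimpleGraph.degree_eq_one_iff_existsUnique_adj.mp hv
  have key : ∀ w : V, w = u ∨ w = v := by
    intro w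
    have h := hT.connected.preconnected u w
    rw [SimpleGraph.reachable_iff_reflTransGen] at h
    induction h with
    | refl => exact Or.inl rfl
    | tail _ hadj ih =>
      rcases ih with rfl | rfl
      · right; rw [hau _ hadj, hau _ huv]
      · left; rw [hbu _ hadj, hbu _ huv.symm]
  have h1 : (Finset.univ.filter (fun v => G.degree v = 1)) ⊆ {u, v} := by
    intro w _
    simpa using key w
  have := Finset.card_le_card h1
  have := Finset.card_le_two (a := u) (b := v)
  omega

open scoped Classical in
theorem internal_edge_count_le (V : Type*) [Fintype V] (G : SimpleGraph V)
    [DecidableRel G.Adj] (hT : G.IsTree) (n : ℕ)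
    (hL : (Finset.univ.filter (fun v => G.degree v = 1)).card = n)
    (hn : 3 ≤ n)
    (hdeg : ∀ v : V, G.degree v = 1 ∨ 3 ≤ G.degree v) :
    (G.edgeFinset.filter (fun e => ∀ v ∈ e, 3 ≤ G.degree v)).card ≤ n - 3 ∧
    ((G.edgeFinset.filter (fun e => ∀ v ∈ e, 3 ≤ G.degree v)).card = n - 3 ↔
      ∀ v : V, G.degree v ≠ 1 → G.degree v = 3) := by
  have hLL := aux_leaf_leaf V G hT (by omega)
  have hE := hT.card_edgeFinset
  have hS := G.sum_degrees_eq_twice_card_edges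
  have hsplit := Finset.card_filter_add_card_filter_not (s := G.edgeFinset)
    (fun e => ∀ v ∈ e, 3 ≤ G.degree v)
  have hV := Finset.card_filter_add_card_filter_not (s := (Finset.univ : Finset V))
    (fun v => G.degree v = 1)
  have hD := Finset.sum_filter_add_sum_filter_not (Finset.univ : Finset V)
    (fun v => G.degree v = 1) (fun v => G.degree v)
  have hD1 : ∑ v ∈ Finset.univ.filter (fun v => G.degree v = 1), G.degree v = n := by
    rw [← hL, Finset.card_eq_sum_ones]
    exact Finset.sum_congr rfl (by simp)
  have hN : (G.edgeFinset.filter (fun e => ¬ ∀ v ∈ e, 3 ≤ G.degree v)).card = n := by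
    rw [← hL]
    have hex : ∀ v, ∃ w, G.degree v = 1 → G.Adj v w ∧ ∀ y, G.Adj v y → y = w := by
      intro v
      by_cases h : G.degree v = 1
      · obtain ⟨a, ha, hau⟩ := SimpleGraph.degree_eq_one_iff_existsUnique_adj.mp h
        exact ⟨a, fun _ => ⟨ha, hau⟩⟩
      · exact ⟨v, fun h' => absurd h' h⟩
    choose f hf using hex
    symm
    refine Finset.card_bij (fun v _ => s(v, f v)) ?_ ?_ ?_
    · intro v hv
      have hv : G.degree v = 1 := by simpa using hv
      rw [Finset.mem_filter, SimpleGraph.mem_edgeFinset, SimpleGraph.mem_edgeSet]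
      refine ⟨(hf v hv).1, fun h => ?_⟩
      have := h v (by simp)
      omega
    · intro v hv w hw h
      have hv : G.degree v = 1 := by simpa using hv
      have hw : G.degree w = 1 := by simpa using hw
      rcases Sym2.eq_iff.mp h with h | h
      · exact h.1
      · exfalso
        have := (hf v hv).1
        rw [h.2] at this
        exact hLL v w hv hw this
    · intro e he
      induction e using Sym2.ind with
      | _ x y =>
      rw [Finset.mem_filter, SimpleGraph.mem_edgeFinset, SimpleGraph.mem_edgeSet] at he
      obtain ⟨hxy, h⟩ := he
      push Not at h
      obtain ⟨v, hv, hlt⟩ := h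
      have hv1 : G.degree v = 1 := by rcases hdeg v with h | h <;> omega
      refine ⟨v, by simpa using hv1, ?_⟩
      rcases Sym2.mem_iff.mp hv with rfl | rfl
      · rw [(hf v hv1).2 _ hxy]
      · rw [(hf v hv1).2 _ hxy.symm, Sym2.eq_swap]
  have h3 : ∀ v ∈ Finset.univ.filter (fun v => ¬ G.degree v = 1), 3 ≤ G.degree v := by
    intro v hv
    have hv : ¬ G.degree v = 1 := by simpa using hv
    exact (hdeg v).resolve_left hv
  have hle := Finset.sum_le_sum h3
  have heq := Finset.sum_eq_sum_iff_of_le h3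
  rw [Finset.sum_const, smul_eq_mul] at hle heq
  have hiff : (∀ v : V, G.degree v ≠ 1 → G.degree v = 3) ↔
      ∀ v ∈ Finset.univ.filter (fun v => ¬ G.degree v = 1), 3 = G.degree v := by
    simp [eq_comm (a := 3)]
  rw [hiff, ← heq]
  rw [Finset.card_univ] at hV
  refine ⟨by omega, by omega⟩
end

section
/- Let V be a finite type and G : SimpleGraph V a tree (G.IsTree). For an edge e of G with endpoints u, v, deleting e from G disconnects G, and the vertex set splits as A_e ∪ A_eᶜ where A_e is the connected component of u in G with e deleted (and A_eᶜ is the component of v). For any two distinct edges e and f of G, the induced bipartitions are compatible: at least one of the four intersections A_e ∩ A_f, A_e ∩ A_fᶜ, A_eᶜ ∩ A_f, A_eᶜ ∩ A_fᶜ is empty. -/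
open SimpleGraph in
lemma cover_aux {V : Type*} (G : SimpleGraph V) (u v : V) {w x : V} (p : G.Walk w x)
    (hx : x = u) :
    (G.deleteEdges {s(u, v)}).Reachable u w ∨ (G.deleteEdges {s(u, v)}).Reachable v w := by
  induction p with
  | nil => subst hx; exact Or.inl (Reachable.refl _)
  | @cons a b c h p ih =>
    by_cases he : s(a, b) = s(u, v)
    · rcases Sym2.eq_iff.1 he with ⟨h1, _⟩ | ⟨h1, _⟩
      · subst h1; exact Or.inl (Reachable.refl _)
      · subst h1; exact Or.inr (Reachable.refl _)
    · have hadj : (G.deleteEdges {s(u, v)}).Adj b a := by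
        rw [deleteEdges_adj]
        exact ⟨h.symm, fun hs => he (Sym2.eq_swap.trans hs)⟩
      exact (ih hx).imp (fun r => r.trans hadj.reachable) (fun r => r.trans hadj.reachable)

open SimpleGraph in
lemma transfer_aux {V : Type*} (G : SimpleGraph V) (e : Sym2 V) (u v : V) {x w : V}
    (p : (G.deleteEdges {e}).Walk x w) (hu : ¬ (G.deleteEdges {e}).Reachable x u) :
    (G.deleteEdges {s(u, v)}).Reachable x w := by
  induction p with
  | nil => exact Reachable.refl _
  | @cons a b c h p ih =>
    have hb : ¬ (G.deleteEdges {e}).Reachable b u := fun r => hu (h.reachable.trans r)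
    have hadj : (G.deleteEdges {s(u, v)}).Adj a b := by
      rw [deleteEdges_adj]
      refine ⟨((deleteEdges_adj).1 h).1, fun he => ?_⟩
      rcases Sym2.eq_iff.1 he with ⟨h1, _⟩ | ⟨_, h1⟩
      · subst h1; exact hu (Reachable.refl _)
      · subst h1; exact hb (Reachable.refl _)
    exact hadj.reachable.trans (ih hb)

theorem tree_edge_bipartitions_compatible {V : Type*} (G : SimpleGraph V)
    (hT : G.IsTree) (u₁ v₁ u₂ v₂ : V)
    (h₁ : G.Adj u₁ v₁) (h₂ : G.Adj u₂ v₂)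
    (hne : s(u₁, v₁) ≠ s(u₂, v₂)) :
    ¬ (G.deleteEdges {s(u₁, v₁)}).Reachable u₁ v₁ ∧
    {w : V | (G.deleteEdges {s(u₁, v₁)}).Reachable u₁ w}ᶜ =
      {w : V | (G.deleteEdges {s(u₁, v₁)}).Reachable v₁ w} ∧
    ({w : V | (G.deleteEdges {s(u₁, v₁)}).Reachable u₁ w} ∩
        {w : V | (G.deleteEdges {s(u₂, v₂)}).Reachable u₂ w} = ∅ ∨
      {w : V | (G.deleteEdges {s(u₁, v₁)}).Reachable u₁ w} ∩
        {w : V | (G.deleteEdges {s(u₂, v₂)}).Reachable u₂ w}ᶜ = ∅ ∨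
      {w : V | (G.deleteEdges {s(u₁, v₁)}).Reachable u₁ w}ᶜ ∩
        {w : V | (G.deleteEdges {s(u₂, v₂)}).Reachable u₂ w} = ∅ ∨
      {w : V | (G.deleteEdges {s(u₁, v₁)}).Reachable u₁ w}ᶜ ∩
        {w : V | (G.deleteEdges {s(u₂, v₂)}).Reachable u₂ w}ᶜ = ∅) := by
  have hb : ∀ u v, G.Adj u v → ¬ (G.deleteEdges {s(u, v)}).Reachable u v := fun u v h =>
    SimpleGraph.isBridge_iff.1 (SimpleGraph.isAcyclic_iff_forall_isBridge.1 hT.2 h)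
  have hc : ∀ u v w, (G.deleteEdges {s(u, v)}).Reachable u w ∨
      (G.deleteEdges {s(u, v)}).Reachable v w := fun u v w => by
    obtain ⟨p⟩ := hT.1.preconnected w u
    exact cover_aux G u v p rfl
  have hcompl : ∀ u v, G.Adj u v → ∀ w, ¬ (G.deleteEdges {s(u, v)}).Reachable u w ↔
      (G.deleteEdges {s(u, v)}).Reachable v w := fun u v h w =>
    ⟨fun hn => (hc u v w).resolve_left hn, fun hv hu => hb u v h (hu.trans hv.symm)⟩
  refine ⟨hb _ _ h₁, Set.ext fun w => hcompl _ _ h₁ w, ?_⟩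
  have key : ∀ x, ¬ (G.deleteEdges {s(u₁, v₁)}).Reachable x u₂ → ∀ w,
      (G.deleteEdges {s(u₁, v₁)}).Reachable x w → (G.deleteEdges {s(u₂, v₂)}).Reachable x w := by
    rintro x hx w ⟨p⟩
    exact transfer_aux G _ u₂ v₂ p hx
  simp only [Set.eq_empty_iff_forall_notMem, Set.mem_inter_iff, Set.mem_compl_iff,
    Set.mem_ofPred_eq, not_and, not_not]
  by_cases hu : (G.deleteEdges {s(u₁, v₁)}).Reachable u₁ u₂
  · have hv : ¬ (G.deleteEdges {s(u₁, v₁)}).Reachable v₁ u₂ :=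
      fun r => (hcompl _ _ h₁ _).2 r hu
    by_cases h2 : (G.deleteEdges {s(u₂, v₂)}).Reachable u₂ v₁
    · exact Or.inr (Or.inr (Or.inr fun w hw =>
        h2.trans (key _ hv w ((hcompl _ _ h₁ w).1 hw))))
    · exact Or.inr (Or.inr (Or.inl fun w hw hr =>
        h2 (hr.trans (key _ hv w ((hcompl _ _ h₁ w).1 hw)).symm)))
  · by_cases h2 : (G.deleteEdges {s(u₂, v₂)}).Reachable u₂ u₁
    · exact Or.inr (Or.inl fun w hw => h2.trans (key _ hu w hw))
    · exact Or.inl fun w hw hr => h2 (hr.trans (key _ hu w hw).symm)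
end
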